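/- Positivity and conservation of the discrete parabolic step. Let 𝒱 be a finite nonempty index set with boundary subset 𝒱^∂, let m_i > 0, ρ_i^n > 0, τ > 0. Suppose: (velocity) B_ij ∈ ℝ^{d×d}, F_i, V_i^n ∈ ℝ^d, V^{1/2} satisfies V_i^{1/2} = 0 for i ∈ 𝒱^∂ and ρ_i^n m_i V_i^{1/2} + (τ/2) Σ_j B_ij V_j^{1/2} = m_i ρ_i^n V_i^n + (τ/2) m_i F_i for i ∉ 𝒱^∂, and V_i^{n+1} := 2V_i^{1/2} − V_i^n; (dissipation) K_i ≥ 0 and Σ_i m_i K_i = Σ_{i,j} V_i^{1/2} · (B_ij V_j^{1/2}); (energy) e_i^n > 0, β_ij ≤ 0 for i ≠ j, Σ_j β_ij = 0 for all i and Σ_i β_ij = 0 for all j, e^L solves m_i ρ_i^n (e_i^L − e_i^n) + τ Σ_j β_ij e_j^L = τ m_i K_i, A_ij = −A_ji, ℓ_ij := min(λ_i^+, λ_j^−) if A_ij ≥ 0 and min(λ_i^−, λ_j^+) otherwise with λ_i^+ := 1, λ_i^− := min(1, Q_i^−/P_i^−) (quotient 0 when P_i^− = 0), P_i^− := Σ_{j≠i}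 min(A_ij,0), Q_i^− := m_i ρ_i^n (min_j e_j^n − e_i^L), and e^{n+1} solves m_i ρ_i^n (e_i^{n+1} − e_i^L) = Σ_{j≠i} ℓ_ij A_ij. Set ρ_i^{n+1} := ρ_i^n, E_i^n := ρ_i^n e_i^n + ½ ρ_i^n ‖V_i^n‖², E_i^{n+1} := ρ_i^{n+1} e_i^{n+1} + ½ ρ_i^n ‖V_i^{n+1}‖². Then: (i) ρ_i^{n+1} = ρ_i^n > 0 for all i; (ii) min_{j} e_j^{n+1} ≥ min_j e_j^n > 0; (iii) Σ_i m_i E_i^{n+1} = Σ_i m_i E_i^n + τ Σ_i m_i F_i · V_i^{1/2}. In particular the updated state (ρ_i^{n+1}, ρ_i^{n+1} V_i^{n+1}, E_i^{n+1}) is admissible (positive density and positive specific internal energy) at every node, for every τ > 0. -/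

import Mathlib

open Matrix Finset

/-- Discrete minimum principle: a backward-Euler step with a zero-row-sum matrix having nonpositive
off-diagonal entries and a nonnegative source preserves lower bounds. -/
lemma le_of_backwardEuler_of_row_sum_eq_zero {ι : Type*} [Fintype ι] [Nonempty ι]
    {w e₀ e s : ι → ℝ} {β : ι → ι → ℝ} {τ c : ℝ}
    (hw : ∀ i, 0 < w i) (hτ : 0 ≤ τ) (hs : ∀ i, 0 ≤ s i)
    (hβ : ∀ i j, i ≠ j → β i j ≤ 0) (hrow : ∀ i, ∑ j, β i j = 0)
    (he : ∀ i, w i * (e i - e₀ i) + τ * ∑ j, β i j * e j = s i)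
    (hc : ∀ i, c ≤ e₀ i) (i : ι) : c ≤ e i := by
  obtain ⟨k, hk⟩ := Finite.exists_min e
  have hsum : ∑ j, β k j * e j ≤ 0 := by
    have hshift : ∑ j, β k j * e j = ∑ j, β k j * (e j - e k) := by
      simp only [mul_sub, Finset.sum_sub_distrib, ← Finset.sum_mul, hrow, zero_mul, sub_zero]
    rw [hshift]
    refine Finset.sum_nonpos fun j _ => ?_
    rcases eq_or_ne k j with rfl | hkj
    · simp
    · exact mul_nonpos_of_nonpos_of_nonneg (hβ k j hkj) (sub_nonneg.2 (hk j))
  have hdiff : 0 ≤ w k * (e k - e₀ k) := by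
    linarith [he k, hs k, mul_nonpos_of_nonneg_of_nonpos hτ hsum]
  linarith [hk i, hc k, nonneg_of_mul_nonneg_right hdiff (hw k)]

/-- The limited antidiffusive increment never drops below the admissible decrement `q`. -/
lemma le_sum_limited_flux {ι : Type*} {s : Finset ι} {a ℓ lam : ι → ℝ} {p q lam₀ : ℝ}
    (hp : p = ∑ j ∈ s, min (a j) 0) (hq : q ≤ 0) (hlam₀ : lam₀ = min 1 (q / p))
    (hlam : ∀ j, 0 ≤ lam j)
    (hℓ : ∀ j, ℓ j = if 0 ≤ a j then min 1 (lam j) else min lam₀ 1) :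
    q ≤ ∑ j ∈ s, ℓ j * a j := by
  have hp0 : p ≤ 0 := hp ▸ Finset.sum_nonpos fun j _ => min_le_right _ _
  have hqp : q ≤ lam₀ * p := by
    rcases hp0.eq_or_lt with h | h
    · simpa [h] using hq
    · exact (le_div_iff_of_neg h).1 (hlam₀ ▸ min_le_right _ _)
  refine hqp.trans ?_
  rw [hp, Finset.mul_sum]
  refine Finset.sum_le_sum fun j _ => ?_
  rw [hℓ j]
  split_ifs with h
  · rw [min_eq_right h, mul_zero]
    exact mul_nonneg (le_min zero_le_one (hlam j)) h
  · rw [min_eq_left (not_le.1 h).le, min_eq_left (hlam₀ ▸ min_le_left _ _)]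

/-- Off-diagonal sums of an antisymmetric array vanish. -/
lemma sum_sum_erase_eq_zero_of_antisymm {ι : Type*} [Fintype ι] [DecidableEq ι]
    {g : ι → ι → ℝ} (hg : ∀ i j, i ≠ j → g i j = -g j i) :
    ∑ i, ∑ j ∈ Finset.univ.erase i, g i j = 0 := by
  have hswap : ∑ i, ∑ j ∈ Finset.univ.erase i, g i j
      = ∑ j, ∑ i ∈ Finset.univ.erase j, g i j :=
    Finset.sum_comm' fun i j => by simp [eq_comm]
  have hneg : ∑ j, ∑ i ∈ Finset.univ.erase j, g i j
      = -∑ j, ∑ i ∈ Finset.univ.erase j, g j i := by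
    simp only [← Finset.sum_neg_distrib]
    exact Finset.sum_congr rfl fun j _ => Finset.sum_congr rfl fun i hi =>
      hg i j (Finset.ne_of_mem_erase hi)
  linarith

/-- The limited fluxes are antisymmetric. -/
lemma limited_flux_antisymm {ι : Type*} {A ℓ : ι → ι → ℝ} {lam : ι → ℝ}
    (hA : ∀ i j, i ≠ j → A i j = -A j i)
    (hℓ : ∀ i j, ℓ i j = if 0 ≤ A i j then min 1 (lam j) else min (lam i) 1)
    (i j : ι) (hij : i ≠ j) : ℓ i j * A i j = -(ℓ j i * A j i) := by
  have h := hA i j hij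
  rcases lt_trichotomy (A i j) 0 with h0 | h0 | h0
  · rw [hℓ i j, hℓ j i, if_neg (not_le.2 h0), if_pos (by linarith), min_comm, h]
    ring
  · have h0' : A j i = 0 := by linarith
    simp [h0, h0']
  · rw [hℓ i j, hℓ j i, if_pos h0.le, if_neg (by linarith), min_comm, h]
    ring

/-- Kinetic-energy increment of an extrapolated midpoint. -/
lemma dotProduct_two_smul_sub_self {d : ℕ} (u v : Fin d → ℝ) :
    ((2 : ℝ) • u - v) ⬝ᵥ ((2 : ℝ) • u - v) = v ⬝ᵥ v + 4 * (u ⬝ᵥ u - u ⬝ᵥ v) := by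
  simp only [sub_dotProduct, dotProduct_sub, smul_dotProduct, dotProduct_smul, smul_eq_mul,
    dotProduct_comm v u]
  ring

/-- Positivity and conservation of the fully discrete parabolic step:
constant positive density, minimum principle for the internal energy, global
total-energy balance, and admissibility of the updated state for every `τ > 0`. -/
theorem parabolic_step_positivity_and_conservation
    {ι : Type*} [Fintype ι] [DecidableEq ι] [Nonempty ι] (d : ℕ)
    (Vb : Finset ι) (m ρn : ι → ℝ) (hm : ∀ i, 0 < m i) (hρ : ∀ i, 0 < ρn i)
    (τ : ℝ) (hτ : 0 < τ)
    -- velocity update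
    (B : ι → ι → Matrix (Fin d) (Fin d) ℝ) (F Vn Vh : ι → Fin d → ℝ)
    (hbc : ∀ i ∈ Vb, Vh i = 0)
    (hveq : ∀ i ∉ Vb,
      (ρn i * m i) • Vh i + (τ / 2) • ∑ j, (B i j).mulVec (Vh j)
        = (m i * ρn i) • Vn i + (τ / 2 * m i) • F i)
    (Vnp : ι → Fin d → ℝ) (hVnp : ∀ i, Vnp i = (2 : ℝ) • Vh i - Vn i)
    -- nodal viscous dissipation
    (K : ι → ℝ) (hK : ∀ i, 0 ≤ K i)
    (hKsum : ∑ i, m i * K i = ∑ i, ∑ j, Vh i ⬝ᵥ (B i j).mulVec (Vh j))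
    -- internal-energy update
    (en : ι → ℝ) (hen : ∀ i, 0 < en i)
    (β : ι → ι → ℝ) (hβneg : ∀ i j, i ≠ j → β i j ≤ 0)
    (hβrow : ∀ i, ∑ j, β i j = 0) (hβcol : ∀ j, ∑ i, β i j = 0)
    (eL : ι → ℝ)
    (hL : ∀ i, m i * ρn i * (eL i - en i) + τ * ∑ j, β i j * eL j = τ * (m i * K i))
    (A : ι → ι → ℝ) (hA : ∀ i j, i ≠ j → A i j = - A j i)
    (P Q lamM : ι → ℝ) (ℓ : ι → ι → ℝ)
    (hP : ∀ i, P i = ∑ j ∈ Finset.univ.erase i, min (A i j) 0)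
    (hQ : ∀ i, Q i
      = m i * ρn i * (Finset.univ.inf' Finset.univ_nonempty en - eL i))
    (hlam : ∀ i, lamM i = min 1 (Q i / P i))
    (hℓ : ∀ i j, ℓ i j = if 0 ≤ A i j then min 1 (lamM j) else min (lamM i) 1)
    (en1 : ι → ℝ)
    (h1 : ∀ i, m i * ρn i * (en1 i - eL i) = ∑ j ∈ Finset.univ.erase i, ℓ i j * A i j)
    -- density and total-energy updates
    (ρ1 : ι → ℝ) (hρ1 : ∀ i, ρ1 i = ρn i)
    (En E1 : ι → ℝ)
    (hEn : ∀ i, En i = ρn i * en i + (1 / 2) * ρn i * (Vn i ⬝ᵥ Vn i))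
    (hE1 : ∀ i, E1 i = ρ1 i * en1 i + (1 / 2) * ρn i * (Vnp i ⬝ᵥ Vnp i)) :
    (∀ i, ρ1 i = ρn i ∧ 0 < ρ1 i)
    ∧ (Finset.univ.inf' Finset.univ_nonempty en1
          ≥ Finset.univ.inf' Finset.univ_nonempty en
        ∧ 0 < Finset.univ.inf' Finset.univ_nonempty en)
    ∧ (∑ i, m i * E1 i = ∑ i, m i * En i + τ * ∑ i, m i * (F i ⬝ᵥ Vh i))
    ∧ (∀ i, 0 < ρ1 i ∧ 0 < en1 i) := by
  set c := Finset.univ.inf' Finset.univ_nonempty en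
  have hcle : ∀ i, c ≤ en i := fun i => Finset.inf'_le _ (Finset.mem_univ i)
  have hcpos : 0 < c := (Finset.lt_inf'_iff _).2 fun i _ => hen i
  have hw : ∀ i, 0 < m i * ρn i := fun i => mul_pos (hm i) (hρ i)
  have heL : ∀ i, c ≤ eL i :=
    le_of_backwardEuler_of_row_sum_eq_zero hw hτ.le
      (fun i => mul_nonneg hτ.le (mul_nonneg (hm i).le (hK i))) hβneg hβrow hL hcle
  have hQ0 : ∀ i, Q i ≤ 0 := fun i => hQ i ▸
    mul_nonpos_of_nonneg_of_nonpos (hw i).le (sub_nonpos.2 (heL i))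
  have hP0 : ∀ i, P i ≤ 0 := fun i => hP i ▸ Finset.sum_nonpos fun j _ => min_le_right _ _
  have hlam0 : ∀ i, 0 ≤ lamM i := fun i => hlam i ▸
    le_min zero_le_one (div_nonneg_of_nonpos (hQ0 i) (hP0 i))
  have hmin : ∀ i, c ≤ en1 i := fun i => by
    have h := le_sum_limited_flux (hP i) (hQ0 i) (hlam i) hlam0 (hℓ i)
    rw [← h1 i, hQ i] at h
    linarith [le_of_mul_le_mul_left h (hw i)]
  have hρ1pos : ∀ i, 0 < ρ1 i := fun i => hρ1 i ▸ hρ i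
  refine ⟨fun i => ⟨hρ1 i, hρ1pos i⟩, ⟨Finset.le_inf' _ _ fun i _ => hmin i, hcpos⟩, ?_,
    fun i => ⟨hρ1pos i, hcpos.trans_le (hmin i)⟩⟩
  have hflux : ∑ i, m i * ρn i * (en1 i - eL i) = 0 := by
    simp only [h1]
    exact sum_sum_erase_eq_zero_of_antisymm (limited_flux_antisymm hA hℓ)
  have hdiffusion : ∑ i, ∑ j, β i j * eL j = 0 := by
    rw [Finset.sum_comm]
    simp only [← Finset.sum_mul, hβcol, zero_mul, Finset.sum_const_zero]
  have hlow : ∑ i, m i * ρn i * (eL i - en i) = τ * ∑ i, m i * K i := by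
    have h := Finset.sum_congr rfl fun i (_ : i ∈ Finset.univ) => hL i
    rwa [Finset.sum_add_distrib, ← Finset.mul_sum, ← Finset.mul_sum, hdiffusion, mul_zero,
      add_zero] at h
  have hkin : ∀ i, 2 * (m i * ρn i) * (Vh i ⬝ᵥ Vh i - Vh i ⬝ᵥ Vn i)
      = τ * (m i * (F i ⬝ᵥ Vh i)) - τ * ∑ j, Vh i ⬝ᵥ (B i j).mulVec (Vh j) := fun i => by
    by_cases hi : i ∈ Vb
    · simp [hbc i hi]
    · have h := congrArg (fun v => Vh i ⬝ᵥ v) (hveq i hi)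
      simp only [dotProduct_add, dotProduct_smul, smul_eq_mul, dotProduct_sum,
        dotProduct_comm (Vh i) (F i)] at h
      linarith
  have hnode : ∀ i, m i * E1 i = m i * En i + m i * ρn i * (en1 i - eL i)
      + m i * ρn i * (eL i - en i)
      + (τ * (m i * (F i ⬝ᵥ Vh i)) - τ * ∑ j, Vh i ⬝ᵥ (B i j).mulVec (Vh j)) := fun i => by
    rw [← hkin i, hE1, hEn, hρ1, hVnp, dotProduct_two_smul_sub_self]
    ring
  simp only [hnode, Finset.sum_add_distrib, Finset.sum_sub_distrib, ← Finset.mul_sum]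
  rw [hflux, hlow, hKsum]
  ring
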